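/- arXiv:2501.05311 — 2 statements merged into one kernel-verified Lean document; each statement's English description precedes it below -/
import Mathlib

section
/- (A three-dimensional eigenspace of the Dirichlet Laplacian on the L-shaped domain at the eigenvalue 50π².) Each of the three functions ψ₁(x,y) = sin(7πx) sin(πy), ψ₂(x,y) = sin(5πx) sin(5πy), ψ₃(x,y) = sin(πx) sin(7πy) vanishes at every point of the frontier of Ω_L and satisfies −Δψᵢ(p) = 50π² ψᵢ(p) for every p ∈ Ω_L; moreover, the restrictions of ψ₁, ψ₂, ψ₃ to Ω_L are linearly independent over ℝ. -/
open MeasureTheory Real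

noncomputable section

abbrev E2 : Type := EuclideanSpace ℝ (Fin 2)

/-- The Laplacian: sum of second partial derivatives in the standard basis. -/
def lap (w : E2 → ℝ) (p : E2) : ℝ :=
  ∑ i : Fin 2, fderiv ℝ (fun q => fderiv ℝ w q (EuclideanSpace.single i 1)) p
    (EuclideanSpace.single i 1)

/-- The L-shaped domain `((-1,1) × (-1,1)) \ ([0,1) × [0,1))`. -/
def OmegaL : Set E2 :=
  {p : E2 | p 0 ∈ Set.Ioo (-1:ℝ) 1 ∧ p 1 ∈ Set.Ioo (-1:ℝ) 1} \
  {p : E2 | p 0 ∈ Set.Ico (0:ℝ) 1 ∧ p 1 ∈ Set.Ico (0:ℝ) 1}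

/-- `ψ₁(x,y) = sin(7πx) sin(πy)`. -/
def psi1 (p : E2) : ℝ := Real.sin (7 * Real.pi * p 0) * Real.sin (Real.pi * p 1)

/-- `ψ₂(x,y) = sin(5πx) sin(5πy)`. -/
def psi2 (p : E2) : ℝ := Real.sin (5 * Real.pi * p 0) * Real.sin (5 * Real.pi * p 1)

/-- `ψ₃(x,y) = sin(πx) sin(7πy)`. -/
def psi3 (p : E2) : ℝ := Real.sin (Real.pi * p 0) * Real.sin (7 * Real.pi * p 1)

theorem hasF_coord (i : Fin 2) (a : ℝ) (p : E2) :
    HasFDerivAt (fun q : E2 => a * q i) (a • (EuclideanSpace.proj i : E2 →L[ℝ] ℝ)) p :=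
  (EuclideanSpace.proj i : E2 →L[ℝ] ℝ).hasFDerivAt.const_mul a

theorem lap_sin_mul_sin (a b : ℝ) (p : E2) :
    lap (fun q => Real.sin (a * q 0) * Real.sin (b * q 1)) p =
      -(a ^ 2 + b ^ 2) * (Real.sin (a * p 0) * Real.sin (b * p 1)) := by
  have h : ∀ q : E2, HasFDerivAt (fun q : E2 => Real.sin (a * q 0) * Real.sin (b * q 1)) _ q :=
    fun q => (hasF_coord 0 a q).sin.mul (hasF_coord 1 b q).sin
  have h0 : (fun q : E2 => fderiv ℝ (fun q : E2 => Real.sin (a * q 0) * Real.sin (b * q 1)) q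
      (EuclideanSpace.single 0 1)) =
      fun q : E2 => a * (Real.cos (a * q 0) * Real.sin (b * q 1)) := by
    funext q
    rw [(h q).fderiv]
    simp
    ring
  have h1 : (fun q : E2 => fderiv ℝ (fun q : E2 => Real.sin (a * q 0) * Real.sin (b * q 1)) q
      (EuclideanSpace.single 1 1)) =
      fun q : E2 => b * (Real.sin (a * q 0) * Real.cos (b * q 1)) := by
    funext q
    rw [(h q).fderiv]
    simp
    ring
  have k0 := (((hasF_coord 0 a p).cos.mul (hasF_coord 1 b p).sin).const_mul a)
  have k1 := (((hasF_coord 0 a p).sin.mul (hasF_coord 1 b p).cos).const_mul b)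
  unfold lap
  rw [Fin.sum_univ_two, h0, h1]
  erw [k0.fderiv, k1.fderiv]
  simp
  ring

theorem isOpen_OmegaL : IsOpen OmegaL := by
  have : OmegaL = {p : E2 | (-1 < p 0 ∧ p 0 < 1) ∧ (-1 < p 1 ∧ p 1 < 1) ∧ (p 0 < 0 ∨ p 1 < 0)} := by
    ext p
    simp only [OmegaL, Set.mem_sdiff, Set.mem_ofPred_eq, Set.mem_Ioo, Set.mem_Ico]
    grind
  rw [this]
  have c0 : Continuous fun p : E2 => p 0 := by fun_prop
  have c1 : Continuous fun p : E2 => p 1 := by fun_prop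
  exact ((isOpen_lt continuous_const c0).inter (isOpen_lt c0 continuous_const)).inter
    (((isOpen_lt continuous_const c1).inter (isOpen_lt c1 continuous_const)).inter
      ((isOpen_lt c0 continuous_const).union (isOpen_lt c1 continuous_const)))

theorem frontier_coord (p : E2) (hp : p ∈ frontier OmegaL) :
    (p 0 = -1 ∨ p 0 = 0 ∨ p 0 = 1) ∨ (p 1 = -1 ∨ p 1 = 0 ∨ p 1 = 1) := by
  rw [isOpen_OmegaL.frontier_eq] at hp
  obtain ⟨hc, hn⟩ := hp
  have c0 : Continuous fun p : E2 => p 0 := by fun_prop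
  have c1 : Continuous fun p : E2 => p 1 := by fun_prop
  have hcl : IsClosed {p : E2 | (-1 ≤ p 0 ∧ p 0 ≤ 1) ∧ (-1 ≤ p 1 ∧ p 1 ≤ 1) ∧
      (p 0 ≤ 0 ∨ p 1 ≤ 0)} :=
    ((isClosed_le continuous_const c0).inter (isClosed_le c0 continuous_const)).inter
    (((isClosed_le continuous_const c1).inter (isClosed_le c1 continuous_const)).inter
      ((isClosed_le c0 continuous_const).union (isClosed_le c1 continuous_const)))
  have hm := closure_minimal (t := {p : E2 | (-1 ≤ p 0 ∧ p 0 ≤ 1) ∧ (-1 ≤ p 1 ∧ p 1 ≤ 1) ∧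
      (p 0 ≤ 0 ∨ p 1 ≤ 0)}) (by
    intro q hq
    simp only [OmegaL, Set.mem_sdiff, Set.mem_ofPred_eq, Set.mem_Ioo, Set.mem_Ico] at hq ⊢
    grind) hcl hc
  simp only [OmegaL, Set.mem_sdiff, Set.mem_ofPred_eq, Set.mem_Ioo, Set.mem_Ico] at hn hm
  grind

theorem sin_zero_of (n : ℕ) (x : ℝ) (h : x = -1 ∨ x = 0 ∨ x = 1) :
    Real.sin (n * Real.pi * x) = 0 := by
  rcases h with h | h | h <;> subst h <;> simp [Real.sin_nat_mul_pi]

theorem sin_ne (k : ℝ) (h0 : 0 < k) (h1 : k < 1) : Real.sin (k * Real.pi) ≠ 0 :=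
  (Real.sin_pos_of_pos_of_lt_pi (by positivity) (by nlinarith [Real.pi_pos])).ne'

theorem mem_OmegaL {x y : ℝ} (hx : -1 < x) (hx0 : x < 0) (hy : -1 < y) (hy0 : y < 0) :
    (!₂[x, y] : E2) ∈ OmegaL := by
  simp only [OmegaL, Set.mem_sdiff, Set.mem_ofPred_eq, Set.mem_Ioo, Set.mem_Ico]
  simp
  grind

/-- A three-dimensional eigenspace of the Dirichlet Laplacian on the L-shaped domain
at the eigenvalue `50π²`. -/
theorem lshape_triple_eigenvalue :
    (∀ p ∈ frontier OmegaL, psi1 p = 0 ∧ psi2 p = 0 ∧ psi3 p = 0) ∧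
    (∀ p ∈ OmegaL,
      -lap psi1 p = 50 * Real.pi ^ 2 * psi1 p ∧
      -lap psi2 p = 50 * Real.pi ^ 2 * psi2 p ∧
      -lap psi3 p = 50 * Real.pi ^ 2 * psi3 p) ∧
    LinearIndependent ℝ ![OmegaL.restrict psi1, OmegaL.restrict psi2, OmegaL.restrict psi3] := by
  refine ⟨fun p hp => ?_, fun p _ => ⟨?_, ?_, ?_⟩, ?_⟩
  · unfold psi1 psi2 psi3
    rcases frontier_coord p hp with h | h <;>
    · have h1 := sin_zero_of 1 _ h
      have h5 := sin_zero_of 5 _ h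
      have h7 := sin_zero_of 7 _ h
      norm_num at h1 h5 h7
      simp [h1, h5, h7]
  · have := lap_sin_mul_sin (7 * Real.pi) Real.pi p
    unfold psi1
    rw [this]
    ring
  · have := lap_sin_mul_sin (5 * Real.pi) (5 * Real.pi) p
    unfold psi2
    rw [this]
    ring
  · have := lap_sin_mul_sin Real.pi (7 * Real.pi) p
    unfold psi3
    rw [this]
    ring
  · rw [Fintype.linearIndependent_iff]
    intro g hg
    have key : ∀ x y : ℝ, -1 < x → x < 0 → -1 < y → y < 0 →
        g 0 * (Real.sin (7 * Real.pi * x) * Real.sin (Real.pi * y)) +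
        g 1 * (Real.sin (5 * Real.pi * x) * Real.sin (5 * Real.pi * y)) +
        g 2 * (Real.sin (Real.pi * x) * Real.sin (7 * Real.pi * y)) = 0 := by
      intro x y hx hx0 hy hy0
      have := congrFun hg ⟨!₂[x, y], mem_OmegaL hx hx0 hy hy0⟩
      simp [Fin.sum_univ_three] at this
      exact this
    have s7 : Real.sin (Real.pi * (-1/7)) ≠ 0 := by
      rw [show Real.pi * (-1/7) = -((1/7) * Real.pi) by ring, Real.sin_neg]
      exact neg_ne_zero.mpr (sin_ne _ (by norm_num) (by norm_num))
    have s75 : Real.sin (7 * Real.pi * (-1/5)) ≠ 0 := by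
      rw [show 7 * Real.pi * (-1/5) = (3/5) * Real.pi - 2 * Real.pi by ring, Real.sin_sub_two_pi]
      exact sin_ne _ (by norm_num) (by norm_num)
    have z7 : Real.sin (7 * Real.pi * (-1/7)) = 0 := by
      rw [show 7 * Real.pi * (-1/7) = -Real.pi by ring]; simp
    have z5 : Real.sin (5 * Real.pi * (-1/5)) = 0 := by
      rw [show 5 * Real.pi * (-1/5) = -Real.pi by ring]; simp
    have s5 : Real.sin (5 * Real.pi * (-1/2)) ≠ 0 := by
      rw [show 5 * Real.pi * (-1/2) = -((1/2) * Real.pi + 2 * Real.pi) by ring, Real.sin_neg,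
        Real.sin_add_two_pi]
      exact neg_ne_zero.mpr (sin_ne _ (by norm_num) (by norm_num))
    have g2 : g 2 = 0 := by
      have := key (-1/7) (-1/5) (by norm_num) (by norm_num) (by norm_num) (by norm_num)
      rw [z7, z5] at this
      simpa only [zero_mul, mul_zero, zero_add, mul_eq_zero, s7, s75, or_false] using this
    have g0 : g 0 = 0 := by
      have := key (-1/5) (-1/7) (by norm_num) (by norm_num) (by norm_num) (by norm_num)
      rw [z7, z5] at this
      simpa only [zero_mul, mul_zero, add_zero, mul_eq_zero, s7, s75, or_false] using this
    have g1 : g 1 = 0 := by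
      have := key (-1/2) (-1/2) (by norm_num) (by norm_num) (by norm_num) (by norm_num)
      rw [g0, g2] at this
      simpa only [zero_mul, zero_add, add_zero, mul_eq_zero, s5, or_false] using this
    intro i
    fin_cases i
    · exact g0
    · exact g1
    · exact g2
end
end

section
/- (Analytic Dirichlet eigenfunctions on the perforated domain.) Let m ≥ 1 be an integer, H = 1/(2m+1), and let Ω_m = ((0,1) × (0,1)) \ ⋃_{i=1..m, l=1..m} ([(2i−1)H, 2iH] × [(2l−1)H, 2lH]) be the unit square with m² closed square holes of edge length H removed. For positive integers j, k, the function ψ(x, y) = sin(jπx/H) sin(kπy/H) vanishes at every point of the frontier of Ω_m, is not identically zero on Ω_m, and satisfies −Δψ(p) = ((jπ/H)² + (kπ/H)²) ψ(p) for every p ∈ Ω_m; that is, ((jπ/H)² + (kπ/H)², ψ) is an eigenpair of the Dirichlet Laplacian on Ω_m. -/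
open MeasureTheory Real

noncomputable section

/-- Hole edge length `H = 1/(2m+1)`. -/
def holeLen (m : ℕ) : ℝ := 1 / (2 * (m : ℝ) + 1)

/-- The perforated domain: the unit square with `m²` closed square holes of edge
length `H = 1/(2m+1)` removed. -/
def OmegaPerf (m : ℕ) : Set E2 :=
  {p : E2 | p 0 ∈ Set.Ioo (0:ℝ) 1 ∧ p 1 ∈ Set.Ioo (0:ℝ) 1} \
  ⋃ (i ∈ Set.Icc 1 m) (l ∈ Set.Icc 1 m),
    {p : E2 | p 0 ∈ Set.Icc ((2 * (i:ℝ) - 1) * holeLen m) (2 * (i:ℝ) * holeLen m) ∧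
              p 1 ∈ Set.Icc ((2 * (l:ℝ) - 1) * holeLen m) (2 * (l:ℝ) * holeLen m)}

lemma aux_cell {t : ℝ} {a : ℤ} (h1 : (a : ℝ) < t) (h2 : t < a + 1) (n : ℤ) :
    ((n : ℝ) ≤ t ↔ n ≤ a) ∧ (t ≤ (n : ℝ) ↔ a + 1 ≤ n) ∧
    ((n : ℝ) < t ↔ n ≤ a) ∧ (t < (n : ℝ) ↔ a + 1 ≤ n) := by
  have A : n ≤ a → (n : ℝ) < t := fun h => lt_of_le_of_lt (by exact_mod_cast h) h1
  have B : a + 1 ≤ n → t < (n : ℝ) := fun h => lt_of_lt_of_le h2 (by exact_mod_cast h)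
  have C : (n : ℝ) ≤ t → n ≤ a := fun h => by
    have : (n : ℝ) < ((a + 1 : ℤ) : ℝ) := by push_cast; linarith
    have := Int.cast_lt.mp this
    omega
  have D : t ≤ (n : ℝ) → a + 1 ≤ n := fun h => by
    have : (a : ℝ) < (n : ℝ) := by linarith
    have := Int.cast_lt.mp this
    omega
  exact ⟨⟨C, fun h => (A h).le⟩, ⟨D, fun h => (B h).le⟩,
    ⟨fun h => C h.le, A⟩, ⟨fun h => D h.le, B⟩⟩

lemma holeLen_pos (m : ℕ) : 0 < holeLen m := by
  unfold holeLen; positivity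

lemma aux_Ioo {m : ℕ} {x : ℝ} {a : ℤ} (h1 : (a : ℝ) < x / holeLen m)
    (h2 : x / holeLen m < a + 1) :
    x ∈ Set.Ioo (0 : ℝ) 1 ↔ (0 ≤ a ∧ a + 1 ≤ 2 * m + 1) := by
  have hH := holeLen_pos m
  have e1 := (aux_cell h1 h2 0).2.2.1
  have e2 := (aux_cell h1 h2 (2 * m + 1)).2.2.2
  rw [← e1, ← e2, lt_div_iff₀ hH, div_lt_iff₀ hH]
  have : (((2 * m + 1 : ℤ) : ℝ)) * holeLen m = 1 := by
    unfold holeLen; push_cast; field_simp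
  rw [this]; simp

lemma aux_Icc {m : ℕ} {x : ℝ} {a : ℤ} (h1 : (a : ℝ) < x / holeLen m)
    (h2 : x / holeLen m < a + 1) (i : ℕ) :
    x ∈ Set.Icc ((2 * (i : ℝ) - 1) * holeLen m) (2 * (i : ℝ) * holeLen m) ↔
      (2 * (i : ℤ) - 1 ≤ a ∧ a + 1 ≤ 2 * (i : ℤ)) := by
  have hH := holeLen_pos m
  have e1 := (aux_cell h1 h2 (2 * i - 1)).1
  have e2 := (aux_cell h1 h2 (2 * i)).2.1
  rw [← e1, ← e2, le_div_iff₀ hH, div_le_iff₀ hH]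
  push_cast
  rfl

lemma aux_mem {m : ℕ} {q : E2} {a b : ℤ} (h1 : (a : ℝ) < q 0 / holeLen m)
    (h2 : q 0 / holeLen m < a + 1) (h3 : (b : ℝ) < q 1 / holeLen m)
    (h4 : q 1 / holeLen m < b + 1) :
    q ∈ OmegaPerf m ↔ (((0 ≤ a ∧ a + 1 ≤ 2 * m + 1) ∧ (0 ≤ b ∧ b + 1 ≤ 2 * m + 1)) ∧
      ¬ ∃ i : ℕ, i ∈ Set.Icc 1 m ∧ ∃ l : ℕ, l ∈ Set.Icc 1 m ∧
        (2 * (i : ℤ) - 1 ≤ a ∧ a + 1 ≤ 2 * (i : ℤ)) ∧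
        (2 * (l : ℤ) - 1 ≤ b ∧ b + 1 ≤ 2 * (l : ℤ))) := by
  unfold OmegaPerf
  simp only [Set.mem_diff, Set.mem_iUnion, Set.mem_setOf_eq, aux_Ioo h1 h2, aux_Ioo h3 h4,
    aux_Icc h1 h2, aux_Icc h3 h4, exists_prop]

lemma aux_sin {m j : ℕ} {x : ℝ} (h : Real.sin (j * Real.pi * x / holeLen m) ≠ 0) :
    ∃ a : ℤ, (a : ℝ) < x / holeLen m ∧ x / holeLen m < a + 1 := by
  refine ⟨⌊x / holeLen m⌋, lt_of_le_of_ne (Int.floor_le _) ?_, Int.lt_floor_add_one _⟩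
  intro e
  apply h
  have : (j * Real.pi * x / holeLen m) = ((j * ⌊x / holeLen m⌋ : ℤ) : ℝ) * Real.pi := by
    push_cast; rw [e]; ring
  rw [this, Real.sin_int_mul_pi]

lemma aux_hasFDerivAt {f g : ℝ → ℝ} {f' g' : ℝ} {p : E2} (hf : HasDerivAt f f' (p 0))
    (hg : HasDerivAt g g' (p 1)) :
    HasFDerivAt (fun q : E2 => f (q 0) * g (q 1))
      (f (p 0) • (g' • (EuclideanSpace.proj 1 : E2 →L[ℝ] ℝ)) +
        g (p 1) • (f' • (EuclideanSpace.proj 0 : E2 →L[ℝ] ℝ))) p := by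
  have h0 : HasFDerivAt (fun q : E2 => q 0) (EuclideanSpace.proj 0 : E2 →L[ℝ] ℝ) p :=
    (EuclideanSpace.proj 0 : E2 →L[ℝ] ℝ).hasFDerivAt
  have h1 : HasFDerivAt (fun q : E2 => q 1) (EuclideanSpace.proj 1 : E2 →L[ℝ] ℝ) p :=
    (EuclideanSpace.proj 1 : E2 →L[ℝ] ℝ).hasFDerivAt
  exact (hf.comp_hasFDerivAt p h0).mul (hg.comp_hasFDerivAt p h1)

lemma aux_d0 {f g : ℝ → ℝ} {f' g' : ℝ} {p : E2} (hf : HasDerivAt f f' (p 0))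
    (hg : HasDerivAt g g' (p 1)) :
    fderiv ℝ (fun q : E2 => f (q 0) * g (q 1)) p (EuclideanSpace.single 0 1)
      = f' * g (p 1) := by
  rw [(aux_hasFDerivAt hf hg).fderiv]
  simp [mul_comm]

lemma aux_d1 {f g : ℝ → ℝ} {f' g' : ℝ} {p : E2} (hf : HasDerivAt f f' (p 0))
    (hg : HasDerivAt g g' (p 1)) :
    fderiv ℝ (fun q : E2 => f (q 0) * g (q 1)) p (EuclideanSpace.single 1 1)
      = f (p 0) * g' := by
  rw [(aux_hasFDerivAt hf hg).fderiv]
  simp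

lemma aux_lap (A B : ℝ) (p : E2) :
    -lap (fun q : E2 => Real.sin (A * q 0) * Real.sin (B * q 1)) p =
      (A ^ 2 + B ^ 2) * (Real.sin (A * p 0) * Real.sin (B * p 1)) := by
  have hs : ∀ C x : ℝ, HasDerivAt (fun t => Real.sin (C * t)) (C * Real.cos (C * x)) x := by
    intro C x
    have := ((hasDerivAt_id x).const_mul C).sin
    simpa [mul_comm] using this
  have hc : ∀ C x : ℝ, HasDerivAt (fun t => C * Real.cos (C * t))
      (-(C ^ 2 * Real.sin (C * x))) x := by
    intro C x
    have := (((hasDerivAt_id x).const_mul C).cos).const_mul C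
    refine this.congr_deriv ?_
    simp; ring
  unfold lap
  rw [Fin.sum_univ_two]
  have e0 : (fun q : E2 => fderiv ℝ (fun q : E2 => Real.sin (A * q 0) * Real.sin (B * q 1)) q
      (EuclideanSpace.single 0 1)) =
      fun q : E2 => (fun t => A * Real.cos (A * t)) (q 0) * (fun t => Real.sin (B * t)) (q 1) := by
    funext q
    exact aux_d0 (hs A (q 0)) (hs B (q 1))
  have e1 : (fun q : E2 => fderiv ℝ (fun q : E2 => Real.sin (A * q 0) * Real.sin (B * q 1)) q
      (EuclideanSpace.single 1 1)) =
      fun q : E2 => (fun t => Real.sin (A * t)) (q 0) * (fun t => B * Real.cos (B * t)) (q 1) := by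
    funext q
    exact aux_d1 (hs A (q 0)) (hs B (q 1))
  rw [e0, e1, aux_d0 (hc A (p 0)) (hs B (p 1)), aux_d1 (hs A (p 0)) (hc B (p 1))]
  ring

/-- Analytic Dirichlet eigenfunctions on the perforated domain:
`((jπ/H)² + (kπ/H)², sin(jπx/H) sin(kπy/H))` is an eigenpair of the Dirichlet
Laplacian on `Ω_m`. -/
theorem perforated_domain_eigenpairs (m : ℕ) (hm : 1 ≤ m) (j k : ℕ)
    (hj : 0 < j) (hk : 0 < k) :
    (∀ p ∈ frontier (OmegaPerf m),
      Real.sin (j * Real.pi * p 0 / holeLen m) * Real.sin (k * Real.pi * p 1 / holeLen m) = 0) ∧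
    (∃ p ∈ OmegaPerf m,
      Real.sin (j * Real.pi * p 0 / holeLen m) * Real.sin (k * Real.pi * p 1 / holeLen m) ≠ 0) ∧
    (∀ p ∈ OmegaPerf m,
      -lap (fun q : E2 =>
          Real.sin (j * Real.pi * q 0 / holeLen m) * Real.sin (k * Real.pi * q 1 / holeLen m)) p =
        ((j * Real.pi / holeLen m) ^ 2 + (k * Real.pi / holeLen m) ^ 2) *
          (Real.sin (j * Real.pi * p 0 / holeLen m) * Real.sin (k * Real.pi * p 1 / holeLen m))) := by
  have hH := holeLen_pos m
  refine ⟨?_, ?_, ?_⟩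
  · intro p hp
    by_contra hne
    obtain ⟨a, h1, h2⟩ := aux_sin (left_ne_zero_of_mul hne)
    obtain ⟨b, h3, h4⟩ := aux_sin (right_ne_zero_of_mul hne)
    have c0 : Continuous fun q : E2 => q 0 / holeLen m := by fun_prop
    have c1 : Continuous fun q : E2 => q 1 / holeLen m := by fun_prop
    have hev : ∀ᶠ q in nhds p, (q ∈ OmegaPerf m ↔ p ∈ OmegaPerf m) := by
      filter_upwards [c0.continuousAt.eventually (lt_mem_nhds h1),
        c0.continuousAt.eventually (gt_mem_nhds h2),
        c1.continuousAt.eventually (lt_mem_nhds h3),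
        c1.continuousAt.eventually (gt_mem_nhds h4)] with q g1 g2 g3 g4
      rw [aux_mem g1 g2 g3 g4, aux_mem h1 h2 h3 h4]
    by_cases hpm : p ∈ OmegaPerf m
    · refine hp.2 (mem_interior_iff_mem_nhds.2 ?_)
      filter_upwards [hev] with q hq
      exact hq.2 hpm
    · have := mem_closure_iff_frequently.1 hp.1
      obtain ⟨q, hq, hq'⟩ := (this.and_eventually hev).exists
      exact hpm (hq'.1 hq)
  · have hH1 : holeLen m ≤ 1 := by
      unfold holeLen
      rw [div_le_one (by positivity)]
      have : (0 : ℝ) ≤ m := by positivity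
      linarith
    have key : ∀ n : ℕ, 0 < n → 0 < holeLen m / (2 * n) ∧ holeLen m / (2 * n) < holeLen m := by
      intro n hn
      have hn' : (1 : ℝ) ≤ n := by exact_mod_cast hn
      refine ⟨by positivity, div_lt_self hH (by linarith)⟩
    have sk : ∀ n : ℕ, 0 < n →
        Real.sin (n * Real.pi * (holeLen m / (2 * n)) / holeLen m) = 1 := by
      intro n hn
      have hn' : (n : ℝ) ≠ 0 := by positivity
      rw [← Real.sin_pi_div_two]
      congr 1
      field_simp
    refine ⟨!₂[holeLen m / (2 * j), holeLen m / (2 * k)], ?_, ?_⟩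
    · unfold OmegaPerf
      simp only [Set.mem_diff, Set.mem_iUnion, Set.mem_setOf_eq, exists_prop]
      refine ⟨⟨⟨(key j hj).1, (key j hj).2.trans_le hH1⟩, (key k hk).1,
        (key k hk).2.trans_le hH1⟩, ?_⟩
      rintro ⟨i, hi, l, hl, hx, hy⟩
      have hi' : (1 : ℝ) ≤ i := by exact_mod_cast hi.1
      have hx1 : (2 * (i : ℝ) - 1) * holeLen m ≤ holeLen m / (2 * j) := hx.1
      have := (key j hj).2
      nlinarith
    · have e : Real.sin (j * Real.pi * (holeLen m / (2 * j)) / holeLen m) *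
          Real.sin (k * Real.pi * (holeLen m / (2 * k)) / holeLen m) ≠ 0 := by
        rw [sk j hj, sk k hk]; norm_num
      exact e
  · intro p _
    have := aux_lap (j * Real.pi / holeLen m) (k * Real.pi / holeLen m) p
    simpa only [div_mul_eq_mul_div] using this
end
end
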